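/- arXiv:1809.05186 — 2 statements merged into one kernel-verified Lean document; each statement's English description precedes it below -/
import Mathlib

section
/- Every metric space has a minimal point-separating set of continuous real-valued functions. -/
def SepFun {X : Type*} [TopologicalSpace X] (F : Set C(X, ℝ)) : Prop :=
  ∀ x y : X, x ≠ y → ∃ f ∈ F, f x ≠ f y

def MinSepFun {X : Type*} [TopologicalSpace X] (F : Set C(X, ℝ)) : Prop :=
  SepFun F ∧ ∀ G ⊂ F, ¬ SepFun G

open Filter Topology Cardinal

/-- A set is uniformly separated. -/
def USep {X : Type*} [MetricSpace X] (S : Set X) : Prop :=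
  ∃ ε > 0, ∀ x ∈ S, ∀ y ∈ S, x ≠ y → ε ≤ dist x y

lemma exists_net {X : Type*} [MetricSpace X] (ε : ℝ) :
    ∃ S : Set X, (∀ x ∈ S, ∀ y ∈ S, x ≠ y → ε ≤ dist x y) ∧
      (0 < ε → ∀ x, ∃ s ∈ S, dist x s < ε) := by
  obtain ⟨S, hS⟩ := zorn_subset {S : Set X | ∀ x ∈ S, ∀ y ∈ S, x ≠ y → ε ≤ dist x y} (by
    intro c hc hchain
    refine ⟨⋃₀ c, ?_, fun s hs => Set.subset_sUnion_of_mem hs⟩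
    rintro x ⟨s, hs, hxs⟩ y ⟨t, ht, hyt⟩ hxy
    rcases hchain.total hs ht with h | h
    · exact hc ht x (h hxs) y hyt hxy
    · exact hc hs x hxs y (h hyt) hxy)
  refine ⟨S, hS.prop, fun hε x => ?_⟩
  by_contra! hcon
  have hx : x ∉ S := fun h => by
    have := hcon x h
    simp at this
    linarith
  have h2 : insert x S ⊆ S := by
    apply hS.le_of_ge _ (Set.subset_insert x S)
    rintro a (rfl | ha) b (rfl | hb) hab
    · exact absurd rfl hab
    · exact hcon b hb
    · rw [dist_comm]; exact hcon a ha
    · exact hS.prop a ha b hb hab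
  exact hx (h2 (Set.mem_insert x S))

lemma usep_finite {X : Type*} [MetricSpace X] (S : Set X) (hS : S.Finite) : USep S := by
  induction S, hS using Set.Finite.induction_on with
  | empty => exact ⟨1, one_pos, by simp⟩
  | @insert a s ha hs ih =>
    obtain ⟨ε, hε, h⟩ := ih
    have : ∀ᶠ r in 𝓝[>] (0 : ℝ), ∀ x ∈ s, r < dist a x := by
      rw [hs.eventually_all]
      intro x hx
      have : 0 < dist a x := dist_pos.2 (fun h => ha (h ▸ hx))
      exact Filter.Eventually.filter_mono nhdsWithin_le_nhds (eventually_lt_nhds this)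
    obtain ⟨r, hr, hr0⟩ := (this.and self_mem_nhdsWithin).exists
    refine ⟨min r ε, lt_min hr0 hε, ?_⟩
    rintro x (rfl | hx) y (rfl | hy) hxy
    · exact absurd rfl hxy
    · exact (min_le_left _ _).trans (hr y hy).le
    · rw [dist_comm]; exact (min_le_left _ _).trans (hr x hx).le
    · exact (min_le_right _ _).trans (h x hx y hy hxy)

lemma USep.mono {X : Type*} [MetricSpace X] {S T : Set X} (hS : USep S) (h : T ⊆ S) : USep T := by
  obtain ⟨ε, hε, h'⟩ := hS
  exact ⟨ε, hε, fun x hx y hy => h' x (h hx) y (h hy)⟩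

lemma USep.noacc {X : Type*} [MetricSpace X] {S : Set X} (hS : USep S) (q : X) :
    ∀ᶠ x in 𝓝[≠] q, x ∉ S := by
  obtain ⟨ε, hε, h⟩ := hS
  by_cases hex : ∃ s ∈ S, s ≠ q ∧ dist s q < ε / 2
  · obtain ⟨s, hs, hsq, hd⟩ := hex
    have h1 : ∀ᶠ x in 𝓝[≠] q, dist x q < min (ε/2) (dist s q) :=
      Filter.Eventually.filter_mono nhdsWithin_le_nhds
        (Metric.ball_mem_nhds q (lt_min (by linarith) (dist_pos.2 hsq)))
    filter_upwards [h1] with x hx hxS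
    rw [lt_min_iff] at hx
    have hne : x ≠ s := by rintro rfl; exact lt_irrefl _ hx.2
    have := h x hxS s hs hne
    have := dist_triangle_right x s q
    linarith
  · push Not at hex
    have h1 : ∀ᶠ x in 𝓝[≠] q, dist x q < ε/2 :=
      Filter.Eventually.filter_mono nhdsWithin_le_nhds
        (Metric.ball_mem_nhds q (by linarith))
    filter_upwards [h1, self_mem_nhdsWithin] with x hx hxq hxS
    have := hex x hxS hxq
    linarith

universe u

lemma usep_card_le {X : Type u} [MetricSpace X] {T S : Set X} {ε δ : ℝ}
    (hT : ∀ x ∈ T, ∀ y ∈ T, x ≠ y → ε ≤ dist x y) (hS : ∀ x, ∃ s ∈ S, dist x s < δ)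
    (h : 2 * δ ≤ ε) : #T ≤ #S := by
  choose f hf hd using hS
  refine Cardinal.mk_le_of_injective (f := fun t : T => (⟨f t, hf t⟩ : S)) ?_
  intro a b hab
  by_contra hne
  have h1 := hT a a.2 b b.2 (fun h => hne (Subtype.ext h))
  have h2 : f a = f b := congrArg Subtype.val hab
  have h3 := hd a
  have h4 := hd b
  rw [← h2] at h4
  have := dist_triangle_right (a : X) b (f a)
  linarith

lemma exists_D (X : Type u) [MetricSpace X] [Infinite X] :
    ∃ (D : Set X) (p : X) (Q : Set X), (∀ q, q ≠ p → ∀ᶠ x in 𝓝[≠] q, x ∉ D) ∧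
      p ∉ D ∧ D.Infinite ∧ Dense Q ∧ #Q ≤ #D := by
  have hfin : ∀ k : ℕ, ∃ T : Set X, USep T ∧ (k : Cardinal) < #T := by
    intro k
    obtain ⟨s, hs⟩ := Infinite.exists_subset_card_eq X (k+1)
    refine ⟨s, usep_finite _ s.finite_toSet, ?_⟩
    have h1 : #(s : Set X) = ((k + 1 : ℕ) : Cardinal) := by
      rw [← hs]; exact Cardinal.mk_coe_finset
    rw [h1]
    exact_mod_cast Nat.lt_succ_self k
  have hnet : ∀ n : ℕ, ∃ S : Set X, USep S ∧ (∀ x, ∃ s ∈ S, dist x s < 1 / ((n:ℝ)+1)) := by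
    intro n
    obtain ⟨S, h1, h2⟩ := exists_net (X := X) (1 / ((n:ℝ)+1))
    have : (0:ℝ) < 1 / ((n:ℝ)+1) := by positivity
    exact ⟨S, ⟨_, this, h1⟩, h2 this⟩
  choose S hS hSd using hnet
  have hF : ∀ T : Set X, USep T → ∀ᶠ n in atTop, #T ≤ #(S n) := by
    rintro T ⟨ε, hε, hT⟩
    have := (tendsto_one_div_add_atTop_nhds_zero_nat (𝕜 := ℝ)).eventually
      (eventually_lt_nhds (show (0:ℝ) < ε / 2 by linarith))
    filter_upwards [this] with n hn
    exact usep_card_le hT (hSd n) (by linarith)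
  -- the reduction
  have key : ∀ (p : X) (D : Set X), (∀ q, q ≠ p → ∀ᶠ x in 𝓝[≠] q, x ∉ D) → p ∉ D →
      (∀ n, #(S n) ≤ #D) → ∃ (D : Set X) (p : X) (Q : Set X),
      (∀ q, q ≠ p → ∀ᶠ x in 𝓝[≠] q, x ∉ D) ∧
      p ∉ D ∧ D.Infinite ∧ Dense Q ∧ #Q ≤ #D := by
    intro p D h1 h2 h3
    have hinf : D.Infinite := by
      rw [← Set.infinite_coe_iff, Cardinal.infinite_iff]
      apply Cardinal.aleph0_le.2
      intro k
      obtain ⟨T, hT, hk⟩ := hfin k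
      obtain ⟨n, hn⟩ := (hF T hT).exists
      exact hk.le.trans (hn.trans (h3 n))
    refine ⟨D, p, ⋃ n, S n, h1, h2, hinf, ?_, ?_⟩
    · rw [Metric.dense_iff]
      intro x r hr
      obtain ⟨n, hn⟩ := exists_nat_one_div_lt hr
      obtain ⟨s, hs, hd⟩ := hSd n x
      exact ⟨s, by rw [Metric.mem_ball, dist_comm]; linarith, Set.mem_iUnion.2 ⟨n, hs⟩⟩
    · have := Cardinal.mk_iUnion_le_sum_mk_lift (f := S)
      rw [Cardinal.lift_uzero] at this
      refine this.trans ?_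
      have hD : ℵ₀ ≤ #D := by
        rw [← Cardinal.infinite_iff]; exact hinf.to_subtype
      refine (Cardinal.sum_le_lift_mk_mul_iSup_lift _).trans ?_
      refine (mul_le_mul' (b := ℵ₀) (d := #D) (by simp) (ciSup_le' (by simpa using h3))).trans ?_
      rw [Cardinal.aleph0_mul_eq hD]
  have remove : ∀ (p : X) (T : Set X) (c : Cardinal.{u}), c < #T → c ≤ #(T \ {p} : Set X) := by
    intro p T c h
    have h1 : #T ≤ #(T \ {p} : Set X) + 1 := by
      refine (Cardinal.mk_le_mk_of_subset (?_ : T ⊆ insert p (T \ {p}))).trans Cardinal.mk_insert_le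
      intro x hx
      by_cases hxp : x = p <;> simp [hx, hxp]
    have := h.trans_le h1
    exact Order.lt_succ_iff.1 (this.trans_le (Cardinal.add_one_le_succ _))
  have p0 : X := Classical.arbitrary X
  by_cases hmax : ∃ T : Set X, USep T ∧ ∀ U : Set X, USep U → #U ≤ #T
  · obtain ⟨T, hT, hm⟩ := hmax
    have hinf : ℵ₀ ≤ #T := Cardinal.aleph0_le.2 fun k => by
      obtain ⟨U, hU, hk⟩ := hfin k
      exact hk.le.trans (hm U hU)
    refine key p0 (T \ {p0}) (fun q _ => (hT.mono Set.sdiff_subset).noacc q) (by simp) fun n => ?_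
    have h1 : #T ≤ #(T \ {p0} : Set X) + 1 := by
      refine (Cardinal.mk_le_mk_of_subset (?_ : T ⊆ insert p0 (T \ {p0}))).trans
        Cardinal.mk_insert_le
      intro x hx
      by_cases hxp : x = p0 <;> simp [hx, hxp]
    have h2 : ℵ₀ ≤ #(T \ {p0} : Set X) := by
      by_contra! hlt
      exact absurd (hinf.trans h1) (not_le.2 (Cardinal.add_lt_aleph0 hlt Cardinal.one_lt_aleph0))
    rw [Cardinal.add_one_eq h2] at h1
    exact (hm _ (hS n)).trans h1
  push Not at hmax
  have hclaim : ∀ c : ℝ, c > 0 → ∀ n, ∃ x : X, ∃ T : Set X, T ⊆ Metric.ball x c ∧ USep T ∧ #(S n) < #T := by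
    intro c hc n
    by_contra! hcon
    obtain ⟨P, hP, hPd⟩ := exists_net (X := X) c
    have hPs : USep P := ⟨c, hc, hP⟩
    have hle : ∀ T : Set X, USep T → #T ≤ #P * #(S n) := by
      intro T hT
      have hsub : T ⊆ ⋃ x : P, T ∩ Metric.ball x c := by
        intro t ht
        obtain ⟨s, hs, hd⟩ := hPd hc t
        exact Set.mem_iUnion.2 ⟨⟨s, hs⟩, ht, hd⟩
      refine (Cardinal.mk_le_mk_of_subset hsub).trans ((Cardinal.mk_iUnion_le _).trans ?_)
      refine mul_le_mul' le_rfl (ciSup_le' fun x => ?_)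
      exact hcon x _ Set.inter_subset_right (hT.mono Set.inter_subset_left)
    rcases lt_or_ge (#P * #(S n)) ℵ₀ with h | h
    · obtain ⟨k, hk⟩ := Cardinal.lt_aleph0.1 h
      obtain ⟨T, hT, hkT⟩ := hfin k
      exact absurd (hle T hT) (by rw [hk]; exact not_le.2 hkT)
    · have hmx : #P * #(S n) ≤ max #P #(S n) := by
        rcases Cardinal.aleph0_le_mul_iff.1 h with ⟨_, _, h' | h'⟩
        · exact (Cardinal.mul_le_max_of_aleph0_le_left h')
        · exact (Cardinal.mul_le_max_of_aleph0_le_right h')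
      have : ∃ T : Set X, USep T ∧ max #P #(S n) < #T := by
        rcases max_choice #P #(S n) with h' | h' <;> rw [h']
        · exact hmax P hPs
        · exact hmax _ (hS n)
      obtain ⟨T, hT, hlt⟩ := this
      exact absurd ((hle T hT).trans hmx) (not_le.2 hlt)
  -- assemble
  have assemble : ∀ (p : X) (T : ℕ → Set X), (∀ n, USep (T n)) → (∀ n, #(S n) < #(T n)) →
      (∀ q ≠ p, ∃ r : ℝ, r > 0 ∧ ∃ N : ℕ, ∀ n ≥ N, ∀ x ∈ T n, r ≤ dist x q) →
      ∃ (D : Set X) (p : X) (Q : Set X),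
      (∀ q, q ≠ p → ∀ᶠ x in 𝓝[≠] q, x ∉ D) ∧
      p ∉ D ∧ D.Infinite ∧ Dense Q ∧ #Q ≤ #D := by
    intro p T hT hc hl
    refine key p (⋃ n, T n \ {p}) ?_ (by simp) ?_
    · intro q hq
      obtain ⟨r, hr, N, hN⟩ := hl q hq
      have h1 : ∀ᶠ x in 𝓝[≠] q, ∀ n ∈ Finset.range N, x ∉ T n := by
        rw [Filter.eventually_all_finset]
        intro n _
        exact (hT n).noacc q
      have h2 : ∀ᶠ x in 𝓝[≠] q, dist x q < r :=
        Filter.Eventually.filter_mono nhdsWithin_le_nhds (Metric.ball_mem_nhds q hr)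
      filter_upwards [h1, h2] with x hx1 hx2 hx
      obtain ⟨n, hn, _⟩ := Set.mem_iUnion.1 hx
      rcases lt_or_ge n N with h | h
      · exact hx1 n (Finset.mem_range.2 h) hn
      · have := hN n h x hn
        linarith
    · intro n
      exact (remove p _ _ (hc n)).trans (Cardinal.mk_le_mk_of_subset
        (Set.subset_iUnion (fun n => T n \ {p}) n))
  by_cases hfull : ∃ y : X, ∀ r : ℝ, r > 0 → ∀ n, ∃ T : Set X, T ⊆ Metric.ball y r ∧ USep T ∧ #(S n) < #T
  · obtain ⟨y, hy⟩ := hfull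
    have := fun n : ℕ => hy (1 / ((n:ℝ)+1)) (by positivity) n
    choose T hTb hT hc using this
    refine assemble y T hT hc fun q hq => ?_
    have hd : 0 < dist q y := dist_pos.2 hq
    obtain ⟨N, hN⟩ := exists_nat_one_div_lt (half_pos hd)
    refine ⟨dist q y / 2, half_pos hd, N, fun n hn x hx => ?_⟩
    have h1 : dist x y < 1 / ((n:ℝ)+1) := hTb n hx
    have h2 := Nat.one_div_le_one_div (α := ℝ) hn
    have := dist_triangle_left q y x
    linarith
  · push Not at hfull
    have := fun n : ℕ => hclaim (1 / ((n:ℝ)+1)) (by positivity) n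
    choose z T hTb hT hc using this
    refine assemble p0 T hT hc fun q _ => ?_
    obtain ⟨r, hr, n, hn⟩ := hfull q
    obtain ⟨N, hN⟩ := exists_nat_one_div_lt (show 0 < r / 4 by linarith)
    obtain ⟨M, hM⟩ := Filter.eventually_atTop.1 (hF _ (hS n))
    refine ⟨r / 4, by linarith, max N M, fun m hm x hx => ?_⟩
    by_contra! hlt
    have h2 := Nat.one_div_le_one_div (α := ℝ) ((le_max_left N M).trans hm)
    have hsub : T m ⊆ Metric.ball q r := by
      intro t ht
      have h3 : dist t (z m) < 1 / ((m:ℝ)+1) := hTb m ht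
      have h4 : dist x (z m) < 1 / ((m:ℝ)+1) := hTb m hx
      have h5 := dist_triangle_right t x (z m)
      have h6 := dist_triangle t x q
      rw [Metric.mem_ball]
      linarith
    have h7 := hn _ hsub (hT m)
    exact absurd (h7.trans (hM m ((le_max_right N M).trans hm))) (not_le.2 (hc m))

lemma infinite_case (X : Type u) [MetricSpace X] [Infinite X] :
    ∃ F : Set C(X, ℝ), MinSepFun F := by
  obtain ⟨D, p, Q, hacc, hp, hDinf, hQ, hQD⟩ := exists_D X
  have : Infinite D := hDinf.to_subtype
  -- enumeration with infinite fibres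
  have hen : ∃ e : D → X, ∀ q ∈ Q, {i | e i = q}.Infinite := by
    have h1 : #(D × ℕ) = #D := by
      rw [Cardinal.mk_prod]
      simp [Cardinal.mul_aleph0_eq (Cardinal.infinite_iff.1 this)]
    obtain ⟨E⟩ := Cardinal.eq.1 h1
    obtain ⟨j⟩ := Cardinal.le_def _ _ |>.1 hQD
    have : Nonempty Q := hQ.nonempty.to_subtype
    refine ⟨fun i => (Function.invFun j (E.symm i).1 : Q), fun q hq => ?_⟩
    refine Set.infinite_of_injective_forall_mem (f := fun n : ℕ => E (j ⟨q, hq⟩, n)) ?_ ?_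
    · intro a b hab
      simpa using hab
    · intro n
      simp [Function.leftInverse_invFun j.injective _]
  obtain ⟨e, he⟩ := hen
  have hrad : ∀ i : D, ∃ r > 0, ∀ d ∈ insert p D, d ≠ i → r ≤ dist d i := by
    intro i
    have hip : (i : X) ≠ p := fun h => hp (h ▸ i.2)
    have h1 := hacc i hip
    have h2 : ∀ᶠ x in 𝓝[≠] (i:X), x ≠ p :=
      Filter.Eventually.filter_mono nhdsWithin_le_nhds (eventually_ne_nhds hip)
    have h3 := h1.and h2
    rw [eventually_nhdsWithin_iff, Metric.eventually_nhds_iff] at h3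
    obtain ⟨r, hr, h⟩ := h3
    refine ⟨r, hr, fun d hd hdi => ?_⟩
    by_contra! hlt
    have := h hlt hdi
    rcases hd with hd | hd
    · exact this.2 hd
    · exact this.1 hd
  choose r hr hrd using hrad
  have hclosed : IsClosed (insert p D) := by
    rw [isClosed_iff_frequently]
    intro x hx
    by_contra hxD
    have hxp : x ≠ p := fun h => hxD (Or.inl h)
    have h1 := eventually_nhdsWithin_iff.1 (hacc x hxp)
    apply hx
    filter_upwards [h1, eventually_ne_nhds hxp] with y hy1 hy2 hy
    rcases hy with hy | hy
    · exact hy2 hy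
    · exact hy1 (fun h : y = x => hxD (Or.inr (h ▸ hy))) hy
  have hne : (insert p D).Nonempty := ⟨p, Or.inl rfl⟩
  let φ : C(X, ℝ) := ⟨fun x => Metric.infDist x (insert p D), Metric.continuous_infDist_pt _⟩
  have hφ : ∀ x, φ x = 0 ↔ x ∈ insert p D := fun x =>
    (hclosed.mem_iff_infDist_zero hne).symm
  let ψ : D → C(X, ℝ) := fun i => ⟨fun x => max 0 (r i / 2 - dist x i), by fun_prop⟩
  have hψd : ∀ (i : D) x, ψ i x = max 0 (r i / 2 - dist x i) := fun _ _ => rfl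
  have hψ : ∀ (i : D) x, ψ i x ≠ 0 → dist x i < r i / 2 := by
    intro i x h
    by_contra! hle
    exact h (by rw [hψd]; exact max_eq_left (by linarith))
  have hψi : ∀ i : D, ψ i i ≠ 0 := by
    intro i
    rw [hψd, dist_self, sub_zero]
    exact (lt_max_of_lt_right (half_pos (hr i))).ne'
  have hψ0 : ∀ (i : D), ∀ d ∈ insert p D, d ≠ i → ψ i d = 0 := by
    intro i d hd hdi
    by_contra h
    have := hψ i d h
    have := hrd i d hd hdi
    have := hr i
    linarith
  have hψu : ∀ (i j : D) x, ψ i x ≠ 0 → ψ j x ≠ 0 → i = j := by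
    intro i j x hi hj
    by_contra hij
    have hij' : (i:X) ≠ j := fun h => hij (Subtype.ext h)
    have h1 := hψ i x hi
    have h2 := hψ j x hj
    have h3 := hrd j i (Or.inr i.2) hij'
    have h4 := hrd i j (Or.inr j.2) hij'.symm
    rw [dist_comm] at h4
    have := dist_triangle_left (i:X) j x
    linarith
  let g : D → C(X, ℝ) := fun i => ⟨fun x => dist x (e i), by fun_prop⟩
  let f : D → C(X, ℝ) := fun i => φ * g i + ψ i
  have hf : ∀ i x, f i x = φ x * dist x (e i) + ψ i x := fun _ _ => rfl
  have hfD : ∀ i, ∀ d ∈ insert p D, f i d = ψ i d := by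
    intro i d hd
    rw [hf, (hφ d).2 hd]; ring
  have hsep : SepFun (insert φ (Set.range f)) := by
    intro x y hxy
    by_cases h : φ x = φ y
    swap
    · exact ⟨φ, Or.inl rfl, h⟩
    by_cases h0 : φ x = 0
    · have hx := (hφ x).1 h0
      have hy := (hφ y).1 (h ▸ h0)
      by_cases hxD : x ∈ D
      · refine ⟨f ⟨x, hxD⟩, Or.inr ⟨_, rfl⟩, ?_⟩
        rw [hfD _ x hx, hfD _ y hy, hψ0 ⟨x, hxD⟩ y hy hxy.symm]
        exact hψi ⟨x, hxD⟩
      · have hxp : x = p := hx.resolve_right hxD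
        have hyD : y ∈ D := hy.resolve_left (fun h => hxy (hxp.trans h.symm))
        refine ⟨f ⟨y, hyD⟩, Or.inr ⟨_, rfl⟩, ?_⟩
        rw [hfD _ x hx, hfD _ y hy, hψ0 ⟨y, hyD⟩ x hx hxy]
        exact (hψi ⟨y, hyD⟩).symm
    · have hd : 0 < dist x y := dist_pos.2 hxy
      obtain ⟨q, hq, hqd⟩ := hQ.exists_dist_lt x (half_pos hd)
      have hfin : ({i | ψ i x ≠ 0} ∪ {i | ψ i y ≠ 0}).Finite := by
        apply Set.Finite.union
        · exact Set.Subsingleton.finite (fun i hi j hj => hψu i j x hi hj)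
        · exact Set.Subsingleton.finite (fun i hi j hj => hψu i j y hi hj)
      obtain ⟨i, hi, hni⟩ := ((he q hq).sdiff hfin).nonempty
      simp only [Set.mem_union, Set.mem_ofPred_eq, not_or, not_not] at hni hi
      refine ⟨f i, Or.inr ⟨_, rfl⟩, ?_⟩
      rw [hf, hf, hni.1, hni.2, hi, ← h, add_zero, add_zero]
      intro heq
      have := mul_left_cancel₀ h0 heq
      have := dist_triangle_right x y q
      linarith
  have hmin : ∀ G : Set C(X, ℝ), G ⊆ insert φ (Set.range f) → SepFun G → Set.range f ⊆ G := by
    rintro G hG hGs _ ⟨i, rfl⟩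
    by_contra hi
    have hip : (i : X) ≠ p := fun h => hp (h ▸ i.2)
    obtain ⟨h, hh, hne⟩ := hGs i p hip
    rcases hG hh with rfl | ⟨j, rfl⟩
    · exact hne (((hφ _).2 (Or.inr i.2)).trans ((hφ _).2 (Or.inl rfl)).symm)
    · have hji : (i : X) ≠ j := fun h => hi (by rwa [Subtype.ext h])
      apply hne
      rw [hfD _ _ (Or.inr i.2), hfD _ _ (Or.inl rfl), hψ0 j i (Or.inr i.2) hji,
        hψ0 j p (Or.inl rfl) (fun h => hp (h ▸ j.2))]
  by_cases hs : SepFun (Set.range f)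
  · refine ⟨Set.range f, hs, fun G hG hGs => hG.2 (hmin G (hG.1.trans (Set.subset_insert _ _)) hGs)⟩
  · refine ⟨_, hsep, fun G hG hGs => ?_⟩
    have h1 := hmin G hG.1 hGs
    by_cases hφG : φ ∈ G
    · exact hG.2 (Set.insert_subset hφG h1)
    · apply hs
      have : G = Set.range f := by
        refine Set.Subset.antisymm (fun x hx => ?_) h1
        exact (hG.1 hx).resolve_left (fun h => hφG (h ▸ hx))
      exact this ▸ hGs

lemma finite_case (X : Type u) [MetricSpace X] [Finite X] :
    ∃ F : Set C(X, ℝ), MinSepFun F := by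
  by_cases h0 : SepFun (∅ : Set C(X, ℝ))
  · exact ⟨∅, h0, fun G hG => False.elim (hG.2 (Set.empty_subset G))⟩
  obtain ⟨n, ⟨e⟩⟩ := Finite.exists_equiv_fin X
  refine ⟨{⟨fun x => ((e x : ℕ) : ℝ), continuous_of_discreteTopology⟩}, ?_, ?_⟩
  · intro x y hxy
    refine ⟨_, rfl, ?_⟩
    simpa [Fin.val_inj] using hxy
  · intro G hG
    rw [Set.ssubset_singleton_iff] at hG
    rwa [hG]

/-- Every metric space has a minimal point-separating set of continuous real-valued
functions. -/
theorem stmt9 (X : Type*) [MetricSpace X] :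
    ∃ F : Set C(X, ℝ), MinSepFun F := by
  rcases finite_or_infinite X with h | h
  · exact finite_case X
  · exact infinite_case X
end

section
/- If a compact Hausdorff space X has a minimal point-separating set of continuous real-valued functions, then X has a minimal point-separating family of functionally open sets. -/
def SepSets {X : Type*} (𝒰 : Set (Set X)) : Prop :=
  ∀ x y : X, x ≠ y → ∃ U ∈ 𝒰, Xor' (x ∈ U) (y ∈ U)

def MinSepSets {X : Type*} (𝒰 : Set (Set X)) : Prop :=
  SepSets 𝒰 ∧ ∀ 𝒱 ⊂ 𝒰, ¬ SepSets 𝒱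

def FunctionallyOpen {X : Type*} [TopologicalSpace X] (U : Set X) : Prop :=
  ∃ (f : C(X, ℝ)) (V : Set ℝ), IsOpen V ∧ U = f ⁻¹' V

theorem xor_iff_aux (P Q : Prop) : Xor' P Q ↔ ¬ (P ↔ Q) := by
  unfold Xor'
  exact xor_iff_not_iff P Q

open Topology Filter in
theorem closed_ins {M : Type*} [MetricSpace M] {p : M} {u : ℕ → M}
    (hu : Tendsto u atTop (𝓝 p)) (N : Set ℕ) : IsClosed (insert p (u '' N)) := by
  classical
  have h1 : Tendsto (fun n => if n ∈ N then u n else p) atTop (𝓝 p) :=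
    Tendsto.if' hu tendsto_const_nhds
  have h2 := h1.isCompact_insert_range.isClosed
  convert h2 using 1
  ext x
  simp only [Set.mem_insert_iff, Set.mem_image, Set.mem_range]
  constructor
  · rintro (h | ⟨n, hn, rfl⟩)
    · exact Or.inl h
    · exact Or.inr ⟨n, by simp [hn]⟩
  · rintro (h | ⟨n, hn⟩)
    · exact Or.inl h
    · by_cases h : n ∈ N
      · exact Or.inr ⟨n, h, by simpa [h] using hn⟩
      · left; simpa [h] using hn.symm

open Topology Filter in
theorem lemA {M : Type*} [MetricSpace M] [SecondCountableTopology M] (p : M) (a b : ℕ → M)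
    (ha : Tendsto a atTop (𝓝 p)) (hb : Tendsto b atTop (𝓝 p))
    (hab : ∀ n, a n ≠ b n) (hap : ∀ n, a n ≠ p)
    (haa : ∀ n m, n ≠ m → a n ≠ a m) (hab' : ∀ n m, n ≠ m → a n ≠ b m)
    (hbb : ∀ n m, n ≠ m → b n ≠ p → b n ≠ b m) :
    ∃ U : ℕ → Set M, (∀ n, IsOpen (U n)) ∧
      (∀ x y, x ≠ y → ∃ n, Xor' (x ∈ U n) (y ∈ U n)) ∧
      (∀ n, a n ∈ U n ∧ b n ∉ U n ∧ ∀ m, m ≠ n → (a n ∈ U m ↔ b n ∈ U m)) := by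
  set S : Set M := insert p (a '' Set.univ) ∪ insert p (b '' Set.univ) with hS
  have hSc : IsClosed S := (closed_ins ha _).union (closed_ins hb _)
  have hpS : p ∈ S := by simp [hS]
  have haS : ∀ n, a n ∈ S := fun n => by simp [hS]
  have hbS : ∀ n, b n ∈ S := fun n => by simp [hS]
  set G : ℕ → Set M := fun n => Metric.ball p (2 * dist (a n) p) ∩
    (insert p (a '' {n}ᶜ) ∪ insert p (b '' Set.univ))ᶜ with hG
  have hGo : ∀ n, IsOpen (G n) := fun n => Metric.isOpen_ball.inter
    ((closed_ins ha _).union (closed_ins hb _)).isOpen_compl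
  have haG : ∀ n, a n ∈ G n := by
    intro n
    have : 0 < dist (a n) p := dist_pos.2 (hap n)
    refine ⟨by rw [Metric.mem_ball]; linarith, ?_⟩
    simp only [Set.mem_compl_iff, Set.mem_union, Set.mem_insert_iff, Set.mem_image,
      Set.mem_singleton_iff, Set.mem_univ, true_and]
    rintro ((h | ⟨m, hm, h⟩) | (h | ⟨m, h⟩))
    · exact hap n h
    · exact haa m n hm h
    · exact hap n h
    · by_cases hnm : n = m
      · subst hnm; exact hab n h.symm
      · exact hab' n m hnm h.symm
  have hGS : ∀ n x, x ∈ S → x ∈ G n → x = a n := by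
    intro n x hx hxG
    have h2 := hxG.2
    simp only [hS, Set.mem_compl_iff, Set.mem_union, Set.mem_insert_iff, Set.mem_image,
      Set.mem_singleton_iff, Set.mem_univ, true_and] at h2 hx
    push Not at h2
    rcases hx with (h | ⟨m, h⟩) | (h | ⟨m, h⟩)
    · exact absurd h h2.1.1
    · by_cases hnm : m = n
      · rw [← h, hnm]
      · exact absurd h (h2.1.2 m hnm)
    · exact absurd h h2.1.1
    · exact absurd h (h2.2.2 m)
  set D : ℕ → Set M := fun n => (insert p (a '' {n}ᶜ) ∪ insert p (b '' {n}ᶜ))ᶜ with hD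
  have hDo : ∀ n, IsOpen (D n) := fun n =>
    ((closed_ins ha _).union (closed_ins hb _)).isOpen_compl
  have hpD : ∀ n, p ∉ D n := fun n => by simp [hD]
  have haD : ∀ n, a n ∈ D n := by
    intro n
    simp only [hD, Set.mem_compl_iff, Set.mem_union, Set.mem_insert_iff, Set.mem_image,
      Set.mem_singleton_iff]
    rintro ((h | ⟨m, hm, h⟩) | (h | ⟨m, hm, h⟩))
    · exact hap n h
    · exact haa m n hm h
    · exact hap n h
    · exact hab' n m (Ne.symm hm) h.symm
  have hbD : ∀ n, b n ≠ p → b n ∈ D n := by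
    intro n hn
    simp only [hD, Set.mem_compl_iff, Set.mem_union, Set.mem_insert_iff, Set.mem_image,
      Set.mem_singleton_iff]
    rintro ((h | ⟨m, hm, h⟩) | (h | ⟨m, hm, h⟩))
    · exact hn h
    · exact hab' m n hm h
    · exact hn h
    · exact hbb n m (Ne.symm hm) hn h.symm
  have hDS : ∀ n x, x ∈ S → x ∈ D n → x = a n ∨ x = b n := by
    intro n x hx h2
    simp only [hD, hS, Set.mem_compl_iff, Set.mem_union, Set.mem_insert_iff, Set.mem_image,
      Set.mem_singleton_iff, Set.mem_univ, true_and] at h2 hx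
    push Not at h2
    rcases hx with (h | ⟨m, h⟩) | (h | ⟨m, h⟩)
    · exact absurd h h2.1.1
    · by_cases hnm : m = n
      · left; rw [← h, hnm]
      · exact absurd h (h2.1.2 m hnm)
    · exact absurd h h2.1.1
    · by_cases hnm : m = n
      · right; rw [← h, hnm]
      · exact absurd h (h2.2.2 m hnm)
  set O : Set (Set M) := insert ∅ (((fun V => V \ S) '' TopologicalSpace.countableBasis M) ∪
    (D '' {n | b n ≠ p})) with hO
  have hOc : O.Countable :=
    (((TopologicalSpace.countable_countableBasis M).image _).union
      ((Set.to_countable _).image _)).insert _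
  have hOcase : ∀ V ∈ O, (IsOpen V ∧ ∀ x ∈ S, x ∉ V) ∨ ∃ n, b n ≠ p ∧ V = D n := by
    rintro V (rfl | ⟨W, hW, rfl⟩ | ⟨n, hn, rfl⟩)
    · exact Or.inl ⟨isOpen_empty, by simp⟩
    · exact Or.inl ⟨((TopologicalSpace.isBasis_countableBasis M).isOpen hW).sdiff hSc,
        fun x hx h => h.2 hx⟩
    · exact Or.inr ⟨n, hn, rfl⟩
  have hOo : ∀ V ∈ O, IsOpen V := by
    intro V hV
    rcases hOcase V hV with h | ⟨n, -, rfl⟩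
    · exact h.1
    · exact hDo n
  have hpO : ∀ V ∈ O, p ∉ V := by
    intro V hV
    rcases hOcase V hV with h | ⟨n, -, rfl⟩
    · exact h.2 p hpS
    · exact hpD n
  have habO : ∀ V ∈ O, ∀ n, (a n ∈ V ↔ b n ∈ V) := by
    intro V hV n
    rcases hOcase V hV with h | ⟨m, hm, rfl⟩
    · exact iff_of_false (h.2 _ (haS n)) (h.2 _ (hbS n))
    · by_cases hnm : n = m
      · subst hnm; exact iff_of_true (haD n) (hbD n hm)
      · refine iff_of_false (fun h => ?_) (fun h => ?_)
        · rcases hDS m _ (haS n) h with h | h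
          · exact haa n m hnm h
          · exact hab' n m hnm h
        · by_cases hbp : b n = p
          · rw [hbp] at h; exact hpD m h
          rcases hDS m _ (hbS n) h with h | h
          · exact hab' m n (Ne.symm hnm) h.symm
          · exact hbb n m hnm hbp h
  obtain ⟨g, hg⟩ := hOc.exists_eq_range ⟨∅, by simp [hO]⟩
  have hgO : ∀ j, g j ∈ O := fun j => hg ▸ Set.mem_range_self j
  set U : ℕ → Set M := fun n => (g (Nat.unpair n).1 \ {a n, b n}) ∪ G n with hU
  have hUev : ∀ x, ∀ᶠ n in atTop, (x ∈ U n ↔ x ∈ g (Nat.unpair n).1) := by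
    intro x
    by_cases hx : x = p
    · subst hx
      refine Eventually.of_forall fun n => iff_of_false ?_ (hpO _ (hgO _))
      rintro (h | h)
      · exact hpO _ (hgO _) h.1
      · exact hap n (hGS n _ hpS h).symm
    · have h1 : ∀ᶠ n in atTop, a n ≠ x := ha.eventually_ne (Ne.symm hx)
      have h2 : ∀ᶠ n in atTop, b n ≠ x := hb.eventually_ne (Ne.symm hx)
      have h3 : ∀ᶠ n in atTop, dist (a n) p < dist x p / 2 :=
        (Metric.tendsto_nhds.1 ha) _ (half_pos (dist_pos.2 hx))
      filter_upwards [h1, h2, h3] with n h1 h2 h3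
      have h4 : x ∉ G n := fun h => by
        have := h.1
        rw [Metric.mem_ball] at this
        linarith
      simp only [hU, Set.mem_union, Set.mem_sdiff, Set.mem_insert_iff, Set.mem_singleton_iff, h4,
        h1.symm, h2.symm]
      simp
  have hUa : ∀ n, a n ∈ U n := fun n => Or.inr (haG n)
  have hUb : ∀ n, b n ∉ U n := by
    rintro n (h | h)
    · exact h.2 (by simp)
    · exact hab n (hGS n _ (hbS n) h).symm
  have hsepO : ∀ x y, (∃ V ∈ O, Xor' (x ∈ V) (y ∈ V)) → ∃ n, Xor' (x ∈ U n) (y ∈ U n) := by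
    rintro x y ⟨V, hV, hxy⟩
    rw [hg] at hV
    obtain ⟨j, rfl⟩ := hV
    obtain ⟨N, hN⟩ := eventually_atTop.1 ((hUev x).and (hUev y))
    have := hN (Nat.pair j N) (Nat.right_le_pair j N)
    simp only [Nat.unpair_pair] at this
    exact ⟨Nat.pair j N, by rw [this.1, this.2]; exact hxy⟩
  refine ⟨U, fun n => ?_, ?_, fun n => ⟨hUa n, hUb n, fun m hmn => ?_⟩⟩
  · exact ((hOo _ (hgO _)).sdiff (Set.toFinite _).isClosed).union (hGo n)
  · -- separation
    have key : ∀ x y, x ≠ y → x ≠ p → ∃ n, Xor' (x ∈ U n) (y ∈ U n) := by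
      intro x y hxy hxp
      by_contra hcon
      have hno : ∀ V ∈ O, (x ∈ V ↔ y ∈ V) := by
        intro V hV
        by_contra h
        exact hcon (hsepO x y ⟨V, hV, by rwa [xor_iff_aux]⟩)
      have hno' : ∀ n, (x ∈ U n ↔ y ∈ U n) := by
        intro n
        by_contra h
        exact hcon ⟨n, by rwa [xor_iff_aux]⟩
      have hbas : ∀ u v : M, u ≠ v → (∀ V ∈ O, (u ∈ V ↔ v ∈ V)) → u ∈ S := by
        intro u v huv h
        by_contra hu
        obtain ⟨V, hV, huV, hsub⟩ :=
          (TopologicalSpace.isBasis_countableBasis M).exists_subset_of_mem_open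
            (show u ∈ ({v}ᶜ : Set M) from huv) isOpen_compl_singleton
        have := (h (V \ S) (Or.inr (Or.inl ⟨V, hV, rfl⟩))).1 ⟨huV, hu⟩
        exact hsub this.1 rfl
      have hxS := hbas x y hxy hno
      have hyS := hbas y x hxy.symm (fun V hV => (hno V hV).symm)
      by_cases hxD : ∃ n, b n ≠ p ∧ x ∈ D n
      · obtain ⟨n, hn, hx⟩ := hxD
        have hy := (hno (D n) (Or.inr (Or.inr ⟨n, hn, rfl⟩))).1 hx
        have h5 := hno' n
        rcases hDS n x hxS hx with h | h <;> rcases hDS n y hyS hy with h' | h'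
        · exact hxy (h.trans h'.symm)
        · rw [h, h'] at h5; exact hUb n (h5.1 (hUa n))
        · rw [h, h'] at h5; exact hUb n (h5.2 (hUa n))
        · exact hxy (h.trans h'.symm)
      · have hxa : ∃ n, x = a n := by
          rcases hxS with (h | ⟨n, -, h⟩) | (h | ⟨n, -, h⟩)
          · exact absurd h hxp
          · exact ⟨n, h.symm⟩
          · exact absurd h hxp
          · subst h; exact absurd ⟨n, hxp, hbD n hxp⟩ hxD
        obtain ⟨n, rfl⟩ := hxa
        rcases (hno' n).1 (hUa n) with h | h
        · have h6 := (hno _ (hgO _)).2 h.1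
          rcases hOcase _ (hgO (Nat.unpair n).1) with h7 | ⟨m, hm, h7⟩
          · exact h7.2 _ hxS h6
          · rw [h7] at h6; exact hxD ⟨m, hm, h6⟩
        · exact hxy (hGS n y hyS h).symm
    intro x y hxy
    by_cases hx : x = p
    · obtain ⟨n, hn⟩ := key y x hxy.symm (fun h => hxy (hx.trans h.symm))
      exact ⟨n, hn.symm⟩
    · exact key x y hxy hx
  · have h1 : a n ∉ G m := fun h => haa n m hmn.symm (hGS m _ (haS n) h)
    have h2 : b n ∉ G m := fun h => hab' m n hmn (hGS m _ (hbS n) h).symm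
    have h3 := haa n m hmn.symm
    have h4 := hab' n m hmn.symm
    have h5 : b n ≠ a m := (hab' m n hmn).symm
    have h6 := habO _ (hgO (Nat.unpair m).1) n
    have h7 := hpO _ (hgO (Nat.unpair m).1)
    simp only [hU, Set.mem_union, Set.mem_sdiff, Set.mem_insert_iff, Set.mem_singleton_iff, h1, h2,
      h3, h4, h5, or_false, false_or, not_false_eq_true, and_true]
    rw [h6]
    refine ⟨fun h => ⟨h, fun h8 => ?_⟩, fun h => h.1⟩
    by_cases hbp : b n = p
    · rw [hbp] at h; exact h7 h
    · exact hbb n m hmn.symm hbp h8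

open Topology Filter in
theorem lemB {M : Type*} [TopologicalSpace M] [TopologicalSpace.MetrizableSpace M]
    [SecondCountableTopology M] (p : M) (E : M → M → Prop) (hE : ∀ x y, E x y → E y x)
    (h : ∀ W ∈ 𝓝 p, ∃ x ∈ W, ∃ y ∈ W, E x y ∧ x ≠ y) :
    ∃ U : ℕ → Set M, (∀ n, IsOpen (U n)) ∧
      (∀ x y, x ≠ y → ∃ n, Xor' (x ∈ U n) (y ∈ U n)) ∧
      (∀ n, ∃ x y, E x y ∧ x ∈ U n ∧ y ∉ U n ∧ ∀ m, m ≠ n → (x ∈ U m ↔ y ∈ U m)) := by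
  letI := TopologicalSpace.metrizableSpaceMetric M
  have h' : ∀ ε > 0, ∃ z : M × M, (E z.1 z.2 ∧ z.1 ≠ z.2 ∧ z.1 ≠ p) ∧
      dist z.1 p < ε ∧ dist z.2 p < ε := by
    intro ε hε
    obtain ⟨x, hx, y, hy, hxy, hne⟩ := h _ (Metric.ball_mem_nhds p hε)
    by_cases hxp : x = p
    · exact ⟨(y, x), ⟨hE _ _ hxy, hne.symm, fun h => hne (hxp.trans h.symm)⟩, hy, hx⟩
    · exact ⟨(x, y), ⟨hxy, hne, hxp⟩, hx, hy⟩
  let r : M × M → M × M → Prop := fun z w =>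
    (dist w.1 p < dist z.1 p / 2 ∧ dist w.2 p < dist z.1 p / 2) ∧
    (z.2 ≠ p → dist w.1 p < dist z.2 p ∧ dist w.2 p < dist z.2 p)
  obtain ⟨f, hf, hr⟩ := exists_seq_of_forall_finset_exists
    (fun z : M × M => E z.1 z.2 ∧ z.1 ≠ z.2 ∧ z.1 ≠ p) r (by
      intro s hs
      have : ∀ z ∈ s, ∀ᶠ ε in 𝓝[>] (0:ℝ), ε < dist z.1 p / 2 ∧ (z.2 ≠ p → ε < dist z.2 p) := by
        intro z hz
        have h1 : ∀ᶠ ε in 𝓝[>] (0:ℝ), ε < dist z.1 p / 2 :=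
          nhdsWithin_le_nhds (gt_mem_nhds (half_pos (dist_pos.2 (hs z hz).2.2)))
        by_cases hz2 : z.2 = p
        · filter_upwards [h1] with ε hε using ⟨hε, fun h => absurd hz2 h⟩
        · have h2 : ∀ᶠ ε in 𝓝[>] (0:ℝ), ε < dist z.2 p :=
            nhdsWithin_le_nhds (gt_mem_nhds (dist_pos.2 hz2))
          filter_upwards [h1, h2] with ε hε h3 using ⟨hε, fun _ => h3⟩
      have h2 := (Filter.eventually_all_finset s).2 this
      obtain ⟨ε, h3, h4⟩ := (h2.and self_mem_nhdsWithin).exists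
      obtain ⟨w, hw, hw1, hw2⟩ := h' ε h4
      refine ⟨w, hw, fun z hz => ⟨⟨hw1.trans (h3 z hz).1, hw2.trans (h3 z hz).1⟩, fun hne =>
        ⟨hw1.trans ((h3 z hz).2 hne), hw2.trans ((h3 z hz).2 hne)⟩⟩⟩)
  have hd : ∀ n, dist (f n).1 p ≤ dist (f 0).1 p * (1/2)^n := by
    intro n
    induction n with
    | zero => simp
    | succ n ih =>
      have := (hr n (n+1) (Nat.lt_succ_self n)).1.1
      rw [pow_succ]; linarith
  have ht : Tendsto (fun n : ℕ => dist (f 0).1 p * (1/2:ℝ)^n) atTop (𝓝 0) := by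
    have := (tendsto_pow_atTop_nhds_zero_of_lt_one (r := (1/2:ℝ)) (by norm_num)
      (by norm_num)).const_mul (dist (f 0).1 p)
    simpa using this
  have hta : Tendsto (fun n => (f n).1) atTop (𝓝 p) :=
    tendsto_iff_dist_tendsto_zero.2 (squeeze_zero (fun _ => dist_nonneg) hd ht)
  have htb : Tendsto (fun n => (f n).2) atTop (𝓝 p) := by
    rw [← tendsto_add_atTop_iff_nat 1]
    refine tendsto_iff_dist_tendsto_zero.2 (squeeze_zero (fun _ => dist_nonneg) (fun n => ?_) ht)
    have h1 := (hr n (n+1) (Nat.lt_succ_self n)).1.2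
    have h2 := hd n
    have h3 : 0 ≤ dist (f n).1 p := dist_nonneg
    linarith
  have hpos : ∀ n, 0 < dist (f n).1 p := fun n => dist_pos.2 (hf n).2.2
  obtain ⟨U, hUo, hUs, hUm⟩ := lemA p (fun n => (f n).1) (fun n => (f n).2) hta htb
    (fun n => (hf n).2.1) (fun n => (hf n).2.2)
    (by
      intro n m hnm heq
      rcases lt_or_gt_of_ne hnm with hlt | hlt
      · have := (hr _ _ hlt).1.1
        rw [← heq] at this; linarith [hpos n]
      · have := (hr _ _ hlt).1.1
        rw [← heq] at this; linarith [hpos n])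
    (by
      intro n m hnm heq
      rcases lt_or_gt_of_ne hnm with hlt | hlt
      · have := (hr _ _ hlt).1.2
        rw [← heq] at this; linarith [hpos n]
      · have := ((hr _ _ hlt).2 (by rw [← heq]; exact (hf n).2.2)).1
        rw [← heq] at this; linarith [hpos n])
    (by
      intro n m hnm hne heq
      rcases lt_or_gt_of_ne hnm with hlt | hlt
      · have := ((hr _ _ hlt).2 hne).2
        rw [← heq] at this; exact lt_irrefl _ this
      · have := ((hr _ _ hlt).2 (by rw [← heq]; exact hne)).2
        rw [← heq] at this; exact lt_irrefl _ this)
  exact ⟨U, hUo, hUs, fun n => ⟨_, _, (hf n).1, hUm n⟩⟩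

theorem funOpen_preimage {X M : Type*} [TopologicalSpace X] [TopologicalSpace M]
    [TopologicalSpace.MetrizableSpace M] (h : X → M) (hc : Continuous h) (W : Set M)
    (hW : IsOpen W) : FunctionallyOpen (h ⁻¹' W) := by
  letI := TopologicalSpace.metrizableSpaceMetric M
  by_cases hne : (Wᶜ).Nonempty
  · refine ⟨⟨fun x => Metric.infDist (h x) Wᶜ, (Metric.continuous_infDist_pt _).comp hc⟩,
      {0}ᶜ, isOpen_compl_singleton, ?_⟩
    ext x
    have := hW.isClosed_compl.mem_iff_infDist_zero hne (x := h x)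
    simp only [Set.mem_preimage, ContinuousMap.coe_mk, Set.mem_compl_iff, Set.mem_singleton_iff]
    rw [← this]; simp
  · refine ⟨⟨fun _ => 0, continuous_const⟩, Set.univ, isOpen_univ, ?_⟩
    have : W = Set.univ := by
      rw [Set.not_nonempty_iff_eq_empty] at hne; simpa using hne
    simp [this]

open Topology Filter in
theorem lemC {X I M : Type*} [TopologicalSpace X] [TopologicalSpace M]
    [TopologicalSpace.MetrizableSpace M] [SecondCountableTopology M] (h : I → X → M)
    (hc : ∀ i, Continuous (h i)) (hinj : ∀ x y, x ≠ y → ∃ i, h i x ≠ h i y) (p : I → M)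
    (hp : ∀ i, ∀ W ∈ 𝓝 (p i), ∃ x y, h i x ∈ W ∧ h i y ∈ W ∧ h i x ≠ h i y ∧
      ∀ j, j ≠ i → h j x = h j y) :
    ∃ 𝒰 : Set (Set X), (∀ U ∈ 𝒰, FunctionallyOpen U) ∧ MinSepSets 𝒰 := by
  have key : ∀ i, ∃ U : ℕ → Set M, (∀ n, IsOpen (U n)) ∧
      (∀ x y, x ≠ y → ∃ n, Xor' (x ∈ U n) (y ∈ U n)) ∧
      (∀ n, ∃ x y, (∃ x' y', h i x' = x ∧ h i y' = y ∧ ∀ j, j ≠ i → h j x' = h j y') ∧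
        x ∈ U n ∧ y ∉ U n ∧ ∀ m, m ≠ n → (x ∈ U m ↔ y ∈ U m)) := by
    intro i
    refine lemB (p i) _ ?_ ?_
    · rintro x y ⟨x', y', h1, h2, h3⟩
      exact ⟨y', x', h2, h1, fun j hj => (h3 j hj).symm⟩
    · intro W hW
      obtain ⟨x, y, h1, h2, h3, h4⟩ := hp i W hW
      exact ⟨_, h1, _, h2, ⟨x, y, rfl, rfl, h4⟩, h3⟩
  choose U hUo hUs hUm using key
  refine ⟨Set.range fun q : I × ℕ => h q.1 ⁻¹' U q.1 q.2, ?_, ?_, ?_⟩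
  · rintro _ ⟨q, rfl⟩
    exact funOpen_preimage _ (hc _) _ (hUo _ _)
  · intro x y hxy
    obtain ⟨i, hi⟩ := hinj x y hxy
    obtain ⟨n, hn⟩ := hUs i _ _ hi
    exact ⟨_, ⟨(i, n), rfl⟩, hn⟩
  · intro 𝒱 h𝒱 hsep
    obtain ⟨h1, h2⟩ := h𝒱
    obtain ⟨_, ⟨⟨i, n⟩, rfl⟩, hnot⟩ := Set.not_subset.1 h2
    obtain ⟨_, _, ⟨x, y, rfl, rfl, hj⟩, hx, hy, hm⟩ := hUm i n
    have hxy : x ≠ y := fun h => by subst h; exact hy hx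
    obtain ⟨V, hV, hVxy⟩ := hsep x y hxy
    obtain ⟨⟨j, m⟩, rfl⟩ := h1 hV
    rw [xor_iff_aux] at hVxy
    apply hVxy
    simp only [Set.mem_preimage]
    by_cases hji : j = i
    · subst hji
      by_cases hmn : m = n
      · subst hmn; exact absurd hV hnot
      · exact hm m hmn
    · rw [hj j hji]

/-- If a compact Hausdorff space has a minimal point-separating set of continuous
real-valued functions, then it has a minimal point-separating family of functionally
open sets. -/
theorem stmt18 {X : Type*} [TopologicalSpace X] [CompactSpace X] [T2Space X]
    (F : Set C(X, ℝ)) (hF : MinSepFun F) :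
    ∃ 𝒰 : Set (Set X), (∀ U ∈ 𝒰, FunctionallyOpen U) ∧ MinSepSets 𝒰 := by
  classical
  obtain ⟨hsep, hmin⟩ := hF
  rcases finite_or_infinite F with hfin | hinf
  · rcases finite_or_infinite X with hX | hX
    · have hne : {𝒰 : Set (Set X) | SepSets 𝒰}.Nonempty := by
        refine ⟨Set.univ, fun x y hxy => ⟨{x}, trivial, Or.inl ⟨rfl, fun h => hxy h.symm⟩⟩⟩
      obtain ⟨𝒰, h𝒰⟩ := (Set.toFinite {𝒰 : Set (Set X) | SepSets 𝒰}).exists_minimal hne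
      refine ⟨𝒰, fun U _ => ?_, h𝒰.prop, fun 𝒱 h𝒱 hs => h𝒱.2 (h𝒰.le_of_le hs h𝒱.1)⟩
      refine ⟨⟨fun x => if x ∈ U then 1 else 0, continuous_of_discreteTopology⟩, {0}ᶜ,
        isOpen_compl_singleton, ?_⟩
      ext x
      simp
    · let h : X → (F → ℝ) := fun x f => f.1 x
      have hc : Continuous h := continuous_pi fun f => f.1.continuous
      have hinj : Function.Injective h := by
        intro x y hxy
        by_contra hne
        obtain ⟨f, hf, hfxy⟩ := hsep x y hne
        exact hfxy (congrFun hxy ⟨f, hf⟩)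
      obtain ⟨p, hpK, hp⟩ := (Set.infinite_range_of_injective hinj).exists_accPt_of_subset_isCompact
        (isCompact_range hc) subset_rfl
      obtain ⟨x0, rfl⟩ := hpK
      refine lemC (fun _ : Unit => h) (fun _ => hc) (fun x y hxy => ⟨(), hinj.ne hxy⟩)
        (fun _ => h x0) ?_
      intro i W hW
      obtain ⟨z, ⟨hzW, x, rfl⟩, hz⟩ := accPt_iff_nhds.1 hp W hW
      exact ⟨x, x0, hzW, mem_of_mem_nhds hW, hz, fun j hj => absurd rfl hj⟩
  · have hcard : Cardinal.mk (F × ULift.{_} ℕ) = Cardinal.mk F := by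
      rw [Cardinal.mk_prod]
      simp [Cardinal.mul_aleph0_eq (Cardinal.aleph0_le_mk F)]
    obtain ⟨e'⟩ := Cardinal.eq.1 hcard
    let e : F × ℕ ≃ F := ((Equiv.refl _).prodCongr Equiv.ulift.symm).trans e'
    have hpair : ∀ f : F, ∃ x y : X, f.1 x ≠ f.1 y ∧ ∀ g : F, g ≠ f → g.1 x = g.1 y := by
      intro f
      have := hmin (F \ {f.1}) ⟨Set.diff_subset, fun h => (h f.2).2 rfl⟩
      unfold SepFun at this
      push Not at this
      obtain ⟨x, y, hxy, hg⟩ := this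
      have hg' : ∀ g : F, g ≠ f → g.1 x = g.1 y := fun g hgf =>
        hg g.1 ⟨g.2, fun h => hgf (Subtype.ext h)⟩
      refine ⟨x, y, fun hf => ?_, hg'⟩
      obtain ⟨g, hgF, hgxy⟩ := hsep x y hxy
      by_cases h : (⟨g, hgF⟩ : F) = f
      · subst h; exact hgxy hf
      · exact hgxy (hg' _ h)
    choose a b hab hab' using hpair
    let h : F → X → (ℕ → ℝ) := fun i x n => (e (i, n)).1 x
    have hc : ∀ i, Continuous (h i) := fun i => continuous_pi fun n => (e (i, n)).1.continuous
    have hp : ∀ i, ∃ p : ℕ → ℝ, ∀ W ∈ nhds p, ∃ x y, h i x ∈ W ∧ h i y ∈ W ∧ h i x ≠ h i y ∧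
        ∀ j, j ≠ i → h j x = h j y := by
      intro i
      have hK := (isCompact_range (hc i)).prod (isCompact_range (hc i))
      obtain ⟨⟨p, q⟩, -, φ, hφ, hlim⟩ := hK.tendsto_subseq
        (x := fun n => (h i (a (e (i, n))), h i (b (e (i, n)))))
        (fun n => ⟨⟨_, rfl⟩, ⟨_, rfl⟩⟩)
      have hl1 := (continuous_fst.tendsto _).comp hlim
      have hl2 := (continuous_snd.tendsto _).comp hlim
      have hpq : p = q := by
        ext m
        have h1 := (tendsto_pi_nhds.1 hl1) m
        have h2 := (tendsto_pi_nhds.1 hl2) m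
        refine tendsto_nhds_unique_of_eventuallyEq h1 h2 ?_
        filter_upwards [Filter.eventually_gt_atTop m] with n hn
        have hmn : m ≠ φ n := ne_of_lt (lt_of_lt_of_le hn hφ.le_apply)
        exact hab' (e (i, φ n)) (e (i, m)) (fun h => hmn (by simpa using h))
      subst hpq
      refine ⟨p, fun W hW => ?_⟩
      obtain ⟨n, h1, h2⟩ := ((hl1.eventually hW).and (hl2.eventually hW)).exists
      refine ⟨a (e (i, φ n)), b (e (i, φ n)), h1, h2, fun heq => ?_, fun j hj => ?_⟩
      · exact hab _ (congrFun heq (φ n))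
      · ext m
        exact hab' _ _ (fun h => hj (by have := e.injective h; exact congrArg Prod.fst this))
    choose p hp using hp
    refine lemC h hc ?_ p hp
    intro x y hxy
    obtain ⟨f, hf, hfxy⟩ := hsep x y hxy
    refine ⟨(e.symm ⟨f, hf⟩).1, fun heq => hfxy ?_⟩
    have := congrFun heq (e.symm ⟨f, hf⟩).2
    simpa [h] using this
end
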